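/- Let w be a weight in A_{1,ℛ} on ℝ^{n₁} × ℝ^{n₂}. Then there is a constant depending only on n₁ and n₂ such that for every rectangle R = I₁ × I₂ ∈ ℛ and every f ∈ C²(R), one has ∫_R |f − π_R(f)| w dx dy ≲ ℓ(I₁) ℓ(I₂) [w]_{A_{1,ℛ}}² ∫_R |∇_x∇_y f| w dx dy. -/

import Mathlib

noncomputable section
open MeasureTheory ENNReal Set

abbrev E (m : ℕ) : Type := EuclideanSpace ℝ (Fin m)

/-- Axis-parallel cube in `ℝ^m` with corner `a` and side length `r`. -/
def cube {m : ℕ} (a : E m) (r : ℝ) : Set (E m) :=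
  {x | ∀ i, x i ∈ Set.Icc (a i) (a i + r)}

/-- Rectangle `I₁ × I₂`, a product of two axis-parallel cubes. -/
def rect {n₁ n₂ : ℕ} (a₁ : E n₁) (r₁ : ℝ) (a₂ : E n₂) (r₂ : ℝ) : Set (E n₁ × E n₂) :=
  (cube a₁ r₁) ×ˢ (cube a₂ r₂)

/-- `K` is an admissible `A_{p,ℛ}` constant for `w` (`p > 1`). -/
def rectApBound (n₁ n₂ : ℕ) (p K : ℝ) (w : E n₁ × E n₂ → ℝ) : Prop :=
  ∀ (a₁ : E n₁) (r₁ : ℝ) (a₂ : E n₂) (r₂ : ℝ), 0 < r₁ → 0 < r₂ →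
    ((∫⁻ z in rect a₁ r₁ a₂ r₂, ENNReal.ofReal (w z)) / volume (rect a₁ r₁ a₂ r₂)) *
      (((∫⁻ z in rect a₁ r₁ a₂ r₂, ENNReal.ofReal (w z ^ (-1 / (p - 1)))) /
        volume (rect a₁ r₁ a₂ r₂)) ^ (p - 1)) ≤ ENNReal.ofReal K

/-- `K` is an admissible `A_{1,ℛ}` constant for `w`. -/
def rectA1Bound (n₁ n₂ : ℕ) (K : ℝ) (w : E n₁ × E n₂ → ℝ) : Prop :=
  ∀ (a₁ : E n₁) (r₁ : ℝ) (a₂ : E n₂) (r₂ : ℝ), 0 < r₁ → 0 < r₂ →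
    (∫⁻ z in rect a₁ r₁ a₂ r₂, ENNReal.ofReal (w z)) / volume (rect a₁ r₁ a₂ r₂)
      ≤ ENNReal.ofReal K *
        essInf (fun z => ENNReal.ofReal (w z)) (volume.restrict (rect a₁ r₁ a₂ r₂))

/-- The non-standard average `π_{I₁×I₂}(f)(x,y) = f_{I₁}^y + f_{I₂}^x - f_{I₁×I₂}`. -/
def piR {n₁ n₂ : ℕ} (a₁ : E n₁) (r₁ : ℝ) (a₂ : E n₂) (r₂ : ℝ)
    (f : E n₁ × E n₂ → ℝ) (z : E n₁ × E n₂) : ℝ :=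
  (⨍ x in cube a₁ r₁, f (x, z.2)) + (⨍ y in cube a₂ r₂, f (z.1, y)) -
    ⨍ u in rect a₁ r₁ a₂ r₂, f u

/-- Mixed second partial `∂²f/∂xᵢ∂yⱼ`. -/
def mixedPartial {n₁ n₂ : ℕ} (f : E n₁ × E n₂ → ℝ) (i : Fin n₁) (j : Fin n₂)
    (z : E n₁ × E n₂) : ℝ :=
  fderiv ℝ (fun x => fderiv ℝ (fun y => f (x, y)) z.2 (EuclideanSpace.single j (1:ℝ))) z.1
    (EuclideanSpace.single i (1:ℝ))

/-- Hilbert–Schmidt norm `|∇ₓ∇_y f|` of the mixed-derivative matrix. -/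
def mixedGradNorm {n₁ n₂ : ℕ} (f : E n₁ × E n₂ → ℝ) (z : E n₁ × E n₂) : ℝ :=
  Real.sqrt (∑ i : Fin n₁, ∑ j : Fin n₂, (mixedPartial f i j z) ^ 2)

/-- Weighted `L^p` "norm" on a set, as an extended nonnegative real. -/
def lpW {α : Type*} [MeasureSpace α] (p : ℝ) (A : Set α) (w : α → ℝ) (g : α → ℝ) : ℝ≥0∞ :=
  (∫⁻ z in A, ENNReal.ofReal |g z| ^ p * ENNReal.ofReal (w z)) ^ (1 / p)


/-- The fundamental theorem of calculus along a segment, as an inequality of extended norms. -/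
theorem enorm_sub_le_lintegral_fderiv_segment {F : Type*} [NormedAddCommGroup F]
    [NormedSpace ℝ F] {g : F → ℝ} (hg : ContDiff ℝ 1 g) (x x' : F) :
    ‖g x' - g x‖ₑ ≤
      ∫⁻ a in Ioc (0:ℝ) 1, ‖fderiv ℝ g (x + a • (x' - x)) (x' - x)‖ₑ := by
  have hc : ContDiff ℝ 1 fun a : ℝ => g (x + a • (x' - x)) := by fun_prop
  have h := enorm_sub_le_lintegral_deriv_of_contDiffOn_Icc hc.contDiffOn zero_le_one
  rw [setLIntegral_congr Ioc_ae_eq_Icc.symm] at h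
  have hd : ∀ a : ℝ, deriv (fun a : ℝ => g (x + a • (x' - x))) a =
      fderiv ℝ g (x + a • (x' - x)) (x' - x) := fun a => by
    have hl : HasDerivAt (fun a : ℝ => x + a • (x' - x)) (x' - x) a := by
      simpa using ((hasDerivAt_id a).smul_const (x' - x)).const_add x
    exact ((hg.differentiable one_ne_zero _).hasFDerivAt.comp_hasDerivAt a hl).deriv
  simpa [hd] using h

theorem contDiff_fderiv_snd {n₁ n₂ : ℕ} {f : E n₁ × E n₂ → ℝ} (hf : ContDiff ℝ 2 f) (v : E n₂) :
    ContDiff ℝ 1 fun z : E n₁ × E n₂ => fderiv ℝ (fun y => f (z.1, y)) z.2 v := by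
  have h : ContDiff ℝ 1 fun z : E n₁ × E n₂ => fderiv ℝ (fun y => f (z.1, y)) z.2 := by
    refine ContDiff.fderiv (m := 2) (f := fun (z : E n₁ × E n₂) y => f (z.1, y)) ?_ ?_ ?_
    · simp only [Function.uncurry_def]; fun_prop
    · fun_prop
    · norm_num
  exact h.clm_apply contDiff_const

theorem continuous_mixedPartial {n₁ n₂ : ℕ} {f : E n₁ × E n₂ → ℝ} (hf : ContDiff ℝ 2 f)
    (i : Fin n₁) (j : Fin n₂) : Continuous (mixedPartial f i j) := by
  have hp := contDiff_fderiv_snd hf (EuclideanSpace.single j (1:ℝ))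
  have h : ContDiff ℝ 0 fun z : E n₁ × E n₂ => fderiv ℝ
      (fun x => fderiv ℝ (fun y => f (x, y)) z.2 (EuclideanSpace.single j (1:ℝ))) z.1 := by
    refine ContDiff.fderiv (m := 1) (f := fun (z : E n₁ × E n₂) x =>
      fderiv ℝ (fun y => f (x, y)) z.2 (EuclideanSpace.single j (1:ℝ))) ?_ ?_ ?_
    · exact hp.comp (contDiff_snd.prodMk (contDiff_snd.comp contDiff_fst))
    · fun_prop
    · norm_num
  exact (h.clm_apply contDiff_const).continuous

theorem continuous_mixedGradNorm {n₁ n₂ : ℕ} {f : E n₁ × E n₂ → ℝ} (hf : ContDiff ℝ 2 f) :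
    Continuous (mixedGradNorm f) := by
  unfold mixedGradNorm
  have := fun i j => continuous_mixedPartial hf i j
  fun_prop

theorem abs_mixedPartial_le {n₁ n₂ : ℕ} (f : E n₁ × E n₂ → ℝ) (i : Fin n₁) (j : Fin n₂)
    (z : E n₁ × E n₂) : |mixedPartial f i j z| ≤ mixedGradNorm f z := by
  refine Real.abs_le_sqrt ?_
  refine (Finset.single_le_sum (f := fun j => mixedPartial f i j z ^ 2)
    (fun _ _ => sq_nonneg _) (Finset.mem_univ j)).trans ?_
  exact Finset.single_le_sum (f := fun i => ∑ j, mixedPartial f i j z ^ 2)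
    (fun _ _ => Finset.sum_nonneg fun _ _ => sq_nonneg _) (Finset.mem_univ i)

theorem map_eq_sum_single {m : ℕ} (L : E m →L[ℝ] ℝ) (v : E m) :
    L v = ∑ j, v j * L (EuclideanSpace.single j (1:ℝ)) := by
  conv_lhs => rw [← (EuclideanSpace.basisFun (Fin m) ℝ).sum_repr v]
  simp [map_sum]

/-- The mixed second derivative in directions with bounded coordinates is controlled by
the Hilbert–Schmidt norm of the mixed gradient. -/
theorem abs_fderiv_fderiv_le {n₁ n₂ : ℕ} {f : E n₁ × E n₂ → ℝ} (hf : ContDiff ℝ 2 f)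
    {r₁ r₂ : ℝ} (hr₁ : 0 ≤ r₁) {u : E n₁} {v : E n₂}
    (hu : ∀ i, |u i| ≤ r₁) (hv : ∀ j, |v j| ≤ r₂) (x : E n₁) (y : E n₂) :
    |fderiv ℝ (fun ξ => fderiv ℝ (fun η => f (ξ, η)) y v) x u| ≤
      n₁ * n₂ * r₁ * r₂ * mixedGradNorm f (x, y) := by
  have hd : ∀ j : Fin n₂, DifferentiableAt ℝ (fun ξ => fderiv ℝ (fun η => f (ξ, η)) y
      (EuclideanSpace.single j (1:ℝ))) x := fun j =>
    ((contDiff_fderiv_snd hf (EuclideanSpace.single j (1:ℝ))).comp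
      (contDiff_id.prodMk contDiff_const)).differentiable one_ne_zero x
  have key : fderiv ℝ (fun ξ => fderiv ℝ (fun η => f (ξ, η)) y v) x u =
      ∑ i, ∑ j, u i * (v j * mixedPartial f i j (x, y)) := by
    have h1 : (fun ξ => fderiv ℝ (fun η => f (ξ, η)) y v) = fun ξ => ∑ j, v j *
        fderiv ℝ (fun η => f (ξ, η)) y (EuclideanSpace.single j (1:ℝ)) := by
      funext ξ; exact map_eq_sum_single _ _
    rw [map_eq_sum_single]
    refine Finset.sum_congr rfl fun i _ => ?_
    rw [h1, fderiv_fun_sum fun j _ => (hd j).const_mul (v j), sum_apply,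
      Finset.mul_sum]
    refine Finset.sum_congr rfl fun j _ => ?_
    rw [fderiv_const_mul (hd j)]
    rfl
  rw [key]
  calc _ ≤ ∑ i : Fin n₁, ∑ j : Fin n₂, r₁ * (r₂ * mixedGradNorm f (x, y)) := by
        refine (Finset.abs_sum_le_sum_abs _ _).trans (Finset.sum_le_sum fun i _ => ?_)
        refine (Finset.abs_sum_le_sum_abs _ _).trans (Finset.sum_le_sum fun j _ => ?_)
        rw [abs_mul, abs_mul]
        have := abs_mixedPartial_le f i j (x, y)
        have hr₂ := (abs_nonneg _).trans (hv j)
        gcongr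
        exacts [hu i, hv j]
    _ = _ := by simp; ring

/-- The rectangular second difference of `f` is bounded by an integral of its mixed gradient. -/
theorem enorm_doubleDiff_le {n₁ n₂ : ℕ} {f : E n₁ × E n₂ → ℝ} (hf : ContDiff ℝ 2 f)
    {r₁ r₂ : ℝ} (hr₁ : 0 ≤ r₁) {x x' : E n₁} {y y' : E n₂}
    (hx : ∀ i, |(x' - x) i| ≤ r₁) (hy : ∀ j, |(y' - y) j| ≤ r₂) :
    ‖f (x, y) - f (x', y) - f (x, y') + f (x', y')‖ₑ ≤
      ∫⁻ b in Ioc (0:ℝ) 1, ∫⁻ a in Ioc (0:ℝ) 1, ENNReal.ofReal (n₁ * n₂ * r₁ * r₂) *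
        ENNReal.ofReal (mixedGradNorm f (x + a • (x' - x), y + b • (y' - y))) := by
  have hs : ∀ ξ : E n₁, ContDiff ℝ 1 fun η => f (ξ, η) := fun ξ =>
    (hf.of_le one_le_two).comp (contDiff_const.prodMk contDiff_id)
  have h := enorm_sub_le_lintegral_fderiv_segment ((hs x').sub (hs x)) y y'
  have e : f (x, y) - f (x', y) - f (x, y') + f (x', y') =
      (f (x', y') - f (x, y')) - (f (x', y) - f (x, y)) := by ring
  rw [e]
  refine h.trans (lintegral_mono fun b => ?_)
  have hd : ∀ ξ : E n₁, DifferentiableAt ℝ (fun η => f (ξ, η)) (y + b • (y' - y)) :=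
    fun ξ => (hs ξ).differentiable one_ne_zero _
  have hb := enorm_sub_le_lintegral_fderiv_segment
    ((contDiff_fderiv_snd hf (y' - y)).comp
      (contDiff_id.prodMk (contDiff_const (c := y + b • (y' - y))))) x x'
  rw [fderiv_fun_sub (hd x') (hd x)]
  refine hb.trans (lintegral_mono fun a => ?_)
  rw [← ENNReal.ofReal_mul' (q := mixedGradNorm f _) (Real.sqrt_nonneg _), Real.enorm_eq_ofReal_abs]
  exact ENNReal.ofReal_le_ofReal (abs_fderiv_fderiv_le hf hr₁ hx hy _ _)

theorem isCompact_cube {m : ℕ} (a : E m) (r : ℝ) : IsCompact (cube a r) := by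
  have h : cube a r = (EuclideanSpace.equiv (Fin m) ℝ).toHomeomorph ⁻¹'
      (Set.Icc (fun i => a i) (fun i => a i + r)) := by
    ext x; simp [cube, Pi.le_def, forall_and]
  rw [h, Homeomorph.isCompact_preimage]
  exact isCompact_Icc

theorem volume_cube {m : ℕ} (a : E m) (r : ℝ) : volume (cube a r) = ENNReal.ofReal r ^ m := by
  have h : cube a r = WithLp.ofLp ⁻¹' (Set.Icc (fun i => a i) (fun i => a i + r)) := by
    ext x; simp [cube, Pi.le_def, forall_and]
  rw [h, (PiLp.volume_preserving_ofLp (Fin m)).measure_preimage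
    measurableSet_Icc.nullMeasurableSet, Real.volume_Icc_pi]
  simp

theorem isCompact_rect {n₁ n₂ : ℕ} (a₁ : E n₁) (r₁ : ℝ) (a₂ : E n₂) (r₂ : ℝ) :
    IsCompact (rect a₁ r₁ a₂ r₂) := (isCompact_cube a₁ r₁).prod (isCompact_cube a₂ r₂)

theorem measurableSet_rect {n₁ n₂ : ℕ} (a₁ : E n₁) (r₁ : ℝ) (a₂ : E n₂) (r₂ : ℝ) :
    MeasurableSet (rect a₁ r₁ a₂ r₂) := (isCompact_rect a₁ r₁ a₂ r₂).measurableSet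

theorem volume_rect {n₁ n₂ : ℕ} (a₁ : E n₁) (r₁ : ℝ) (a₂ : E n₂) (r₂ : ℝ) :
    volume (rect a₁ r₁ a₂ r₂) = ENNReal.ofReal r₁ ^ n₁ * ENNReal.ofReal r₂ ^ n₂ := by
  rw [rect, Measure.volume_eq_prod, Measure.prod_prod, volume_cube, volume_cube]

theorem abs_sub_le_of_mem_cube {m : ℕ} {a : E m} {r : ℝ} {x y : E m} (hx : x ∈ cube a r)
    (hy : y ∈ cube a r) (i : Fin m) : |(y - x) i| ≤ r := by
  have h1 := hx i
  have h2 := hy i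
  rw [PiLp.sub_apply, abs_le]
  constructor <;> linarith [h1.1, h1.2, h2.1, h2.2]

theorem convex_cube {m : ℕ} (a : E m) (r : ℝ) : Convex ℝ (cube a r) := by
  intro x hx y hy s t hs ht hst i
  exact convex_Icc _ _ (hx i) (hy i) hs ht hst

theorem lintegral_comp_smul_add {m : ℕ} {g : E m → ℝ≥0∞} (hg : Measurable g) {a : ℝ}
    (ha : 0 < a) (c : E m) :
    ∫⁻ x, g (a • x + c) = (ENNReal.ofReal a ^ m)⁻¹ * ∫⁻ x, g x := by
  have h := lintegral_map (μ := (volume : Measure (E m))) (f := fun x => g (x + c))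
    (g := fun x => a • x) (by fun_prop) (by fun_prop)
  rw [← h, Measure.map_addHaar_smul _ ha.ne', lintegral_smul_measure,
    lintegral_add_right_eq_self, abs_of_pos (by positivity), ENNReal.ofReal_inv_of_pos
    (by positivity), finrank_euclideanSpace_fin, ENNReal.ofReal_pow ha.le, smul_eq_mul]

theorem lintegral_comp_prod_smul_add {n₁ n₂ : ℕ} {g : E n₁ × E n₂ → ℝ≥0∞} (hg : Measurable g)
    {a b : ℝ} (ha : 0 < a) (hb : 0 < b) (c : E n₁ × E n₂) :
    ∫⁻ z : E n₁ × E n₂, g (a • z.1 + c.1, b • z.2 + c.2) =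
      (ENNReal.ofReal a ^ n₁)⁻¹ * (ENNReal.ofReal b ^ n₂)⁻¹ * ∫⁻ z, g z := by
  rw [Measure.volume_eq_prod, lintegral_prod _ (by fun_prop), lintegral_prod _ hg.aemeasurable]
  have h : ∀ x : E n₁, ∫⁻ y : E n₂, g (a • x + c.1, b • y + c.2) =
      (ENNReal.ofReal b ^ n₂)⁻¹ * ∫⁻ y, g (a • x + c.1, y) := fun x =>
    lintegral_comp_smul_add (g := fun y => g (a • x + c.1, y)) (by fun_prop) hb c.2
  simp only [h]
  have hm : Measurable fun x : E n₁ => ∫⁻ y : E n₂, g (x, y) := hg.lintegral_prod_right'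
  rw [lintegral_const_mul' _ _ (by simp [hb]), lintegral_comp_smul_add hm ha]
  ring

/-- The rectangle with half-sides `h₁, h₂` centered at `u`. -/
def centeredRect {n₁ n₂ : ℕ} (h₁ h₂ : ℝ) (u : E n₁ × E n₂) : Set (E n₁ × E n₂) :=
  {z | (∀ i, |z.1 i - u.1 i| ≤ h₁) ∧ ∀ j, |z.2 j - u.2 j| ≤ h₂}

theorem isClosed_mem_centeredRect {n₁ n₂ : ℕ} (h₁ h₂ : ℝ) :
    IsClosed {p : (E n₁ × E n₂) × (E n₁ × E n₂) | p.1 ∈ centeredRect h₁ h₂ p.2} := by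
  have : {p : (E n₁ × E n₂) × (E n₁ × E n₂) | p.1 ∈ centeredRect h₁ h₂ p.2} =
      (⋂ i, {p | |p.1.1 i - p.2.1 i| ≤ h₁}) ∩ ⋂ j, {p | |p.1.2 j - p.2.2 j| ≤ h₂} := by
    ext p; simp [centeredRect]
  rw [this]
  exact (isClosed_iInter fun i => isClosed_le (by fun_prop) (by fun_prop)).inter
    (isClosed_iInter fun i => isClosed_le (by fun_prop) (by fun_prop))

theorem measurableSet_centeredRect {n₁ n₂ : ℕ} (h₁ h₂ : ℝ) (u : E n₁ × E n₂) :
    MeasurableSet (centeredRect h₁ h₂ u) :=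
  ((isClosed_mem_centeredRect h₁ h₂).preimage
    (by fun_prop : Continuous fun z : E n₁ × E n₂ => (z, u))).measurableSet

/-- The corner of the cube of side `3 * h` in the grid of mesh `h` with index `k`. -/
def gridCorner {m : ℕ} (h : ℝ) (k : Fin m → ℤ) : E m := WithLp.toLp 2 fun i => h * k i - h

theorem mem_cube_gridCorner {m : ℕ} {h : ℝ} (hh : 0 < h) {u z : E m}
    (hz : ∀ i, |z i - u i| ≤ h) : z ∈ cube (gridCorner h fun i => ⌊u i / h⌋) (3 * h) := by
  intro i
  have h1 := Int.floor_le (u i / h)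
  have h2 := Int.lt_floor_add_one (u i / h)
  rw [le_div_iff₀ hh] at h1
  rw [div_lt_iff₀ hh] at h2
  have h3 := abs_le.1 (hz i)
  simp only [gridCorner, Set.mem_Icc]
  constructor <;> nlinarith

/-- An `A₁` weight dominates, almost everywhere, its averages over centered rectangles of a
fixed size. -/
theorem ae_lintegral_centeredRect_le {n₁ n₂ : ℕ} {K : ℝ} {w : E n₁ × E n₂ → ℝ}
    (hA : rectA1Bound n₁ n₂ K w) {h₁ h₂ : ℝ} (hh₁ : 0 < h₁) (hh₂ : 0 < h₂) :
    ∀ᵐ u, ∫⁻ z in centeredRect h₁ h₂ u, ENNReal.ofReal (w z) ≤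
      ENNReal.ofReal K * (ENNReal.ofReal (3 * h₁) ^ n₁ * ENNReal.ofReal (3 * h₂) ^ n₂) *
        ENNReal.ofReal (w u) := by
  have key : ∀ k : (Fin n₁ → ℤ) × (Fin n₂ → ℤ), ∀ᵐ u,
      u ∈ rect (gridCorner h₁ k.1) (3 * h₁) (gridCorner h₂ k.2) (3 * h₂) →
      ∫⁻ z in rect (gridCorner h₁ k.1) (3 * h₁) (gridCorner h₂ k.2) (3 * h₂),
        ENNReal.ofReal (w z) ≤
      ENNReal.ofReal K * (ENNReal.ofReal (3 * h₁) ^ n₁ * ENNReal.ofReal (3 * h₂) ^ n₂) *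
        ENNReal.ofReal (w u) := fun k => by
    have h := hA (gridCorner h₁ k.1) (3 * h₁) (gridCorner h₂ k.2) (3 * h₂)
      (by positivity) (by positivity)
    rw [← ae_restrict_iff' (measurableSet_rect _ _ _ _)]
    filter_upwards [ae_essInf_le (f := fun z => ENNReal.ofReal (w z))
      (μ := volume.restrict (rect (gridCorner h₁ k.1) (3 * h₁) (gridCorner h₂ k.2) (3 * h₂)))]
      with u hu
    have h' := h.trans (mul_le_mul_right hu _)
    have hp1 : ENNReal.ofReal (3 * h₁) ≠ 0 := by simpa using hh₁
    have hp2 : ENNReal.ofReal (3 * h₂) ≠ 0 := by simpa using hh₂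
    rw [volume_rect, ENNReal.div_le_iff
      (mul_ne_zero (pow_ne_zero _ hp1) (pow_ne_zero _ hp2)) (by finiteness)] at h'
    refine h'.trans_eq (by ring)
  filter_upwards [ae_all_iff.2 key] with u hu
  refine (lintegral_mono_set fun z hz => ?_).trans
    (hu (fun i => ⌊u.1 i / h₁⌋, fun j => ⌊u.2 j / h₂⌋) ?_)
  · exact ⟨mem_cube_gridCorner hh₁ hz.1, mem_cube_gridCorner hh₂ hz.2⟩
  · exact ⟨mem_cube_gridCorner hh₁ (by simp [hh₁.le]), mem_cube_gridCorner hh₂ (by simp [hh₂.le])⟩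

/-- Averaging along contracted rectangles is bounded on the weighted `L¹` space. -/
theorem lintegral_mul_lintegral_contraction_le {n₁ n₂ : ℕ} {W G : E n₁ × E n₂ → ℝ≥0∞}
    (hW : Measurable W) (hG : Measurable G) {κ : ℝ≥0∞} {a₁ : E n₁} {r₁ : ℝ} {a₂ : E n₂} {r₂ : ℝ}
    {a b : ℝ} (ha : a ∈ Ioc (0:ℝ) 1) (hb : b ∈ Ioc (0:ℝ) 1)
    (hA : ∀ᵐ u, ∫⁻ z in centeredRect (a * r₁) (b * r₂) u, W z ≤
      κ * (ENNReal.ofReal (3 * (a * r₁)) ^ n₁ * ENNReal.ofReal (3 * (b * r₂)) ^ n₂) * W u) :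
    ∫⁻ z in rect a₁ r₁ a₂ r₂, ∫⁻ z' in rect a₁ r₁ a₂ r₂,
        G (z.1 + a • (z'.1 - z.1), z.2 + b • (z'.2 - z.2)) * W z ≤
      κ * (ENNReal.ofReal (3 * r₁) ^ n₁ * ENNReal.ofReal (3 * r₂) ^ n₂) *
        ∫⁻ u in rect a₁ r₁ a₂ r₂, G u * W u := by
  obtain ⟨ha0, ha1⟩ := ha
  obtain ⟨hb0, hb1⟩ := hb
  set R := rect a₁ r₁ a₂ r₂ with hR
  have hRm : MeasurableSet R := measurableSet_rect _ _ _ _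
  set D : Set ((E n₁ × E n₂) × (E n₁ × E n₂)) :=
    {p | p.1 ∈ centeredRect (a * r₁) (b * r₂) p.2} ∩ {p | p.2 ∈ R} with hD
  have hDm : MeasurableSet D := (isClosed_mem_centeredRect _ _).measurableSet.inter
    (measurable_snd hRm)
  set k : (E n₁ × E n₂) × (E n₁ × E n₂) → ℝ≥0∞ := D.indicator fun p => G p.2 with hk
  have hkm : Measurable k := (hG.comp measurable_snd).indicator hDm
  set J : ℝ≥0∞ := (ENNReal.ofReal a ^ n₁)⁻¹ * (ENNReal.ofReal b ^ n₂)⁻¹ with hJ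
  have inner : ∀ z ∈ R, ∫⁻ z' in R, G (z.1 + a • (z'.1 - z.1), z.2 + b • (z'.2 - z.2)) * W z ≤
      J * ∫⁻ u, k (z, u) * W z := fun z hz => by
    rw [lintegral_mul_const _ (by fun_prop), lintegral_mul_const _ (by fun_prop), ← mul_assoc]
    gcongr
    have h := lintegral_comp_prod_smul_add (g := fun u => k (z, u)) (by fun_prop) ha0 hb0
      ((1 - a) • z.1, (1 - b) • z.2)
    rw [← h, ← lintegral_indicator hRm]
    refine lintegral_mono fun z' => ?_
    by_cases hz' : z' ∈ R
    · have e1 : z.1 + a • (z'.1 - z.1) = a • z'.1 + (1 - a) • z.1 := by module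
      have e2 : z.2 + b • (z'.2 - z.2) = b • z'.2 + (1 - b) • z.2 := by module
      have hmem : (z, (a • z'.1 + (1 - a) • z.1, b • z'.2 + (1 - b) • z.2)) ∈ D := by
        refine ⟨⟨fun i => ?_, fun j => ?_⟩, ?_, ?_⟩
        · have h1 := abs_sub_le_of_mem_cube hz'.1 hz.1 i
          have h2 : z.1 i - (a • z'.1 + (1 - a) • z.1) i = a * (z.1 - z'.1) i := by
            simp; ring
          simp only [h2, abs_mul, abs_of_pos ha0]
          gcongr
        · have h1 := abs_sub_le_of_mem_cube hz'.2 hz.2 j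
          have h2 : z.2 j - (b • z'.2 + (1 - b) • z.2) j = b * (z.2 - z'.2) j := by
            simp; ring
          simp only [h2, abs_mul, abs_of_pos hb0]
          gcongr
        · exact convex_cube _ _ hz'.1 hz.1 ha0.le (sub_nonneg.2 ha1) (by ring)
        · exact convex_cube _ _ hz'.2 hz.2 hb0.le (sub_nonneg.2 hb1) (by ring)
      rw [indicator_of_mem hz', e1, e2, hk, indicator_of_mem hmem]
    · simp [indicator_of_notMem hz']
  have outer : ∀ u, ∫⁻ z, k (z, u) * W z =
      R.indicator (fun u => G u * ∫⁻ z in centeredRect (a * r₁) (b * r₂) u, W z) u := fun u => by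
    by_cases hu : u ∈ R
    · rw [indicator_of_mem hu, ← lintegral_const_mul _ hW,
        ← lintegral_indicator (measurableSet_centeredRect _ _ _)]
      refine lintegral_congr fun z => ?_
      by_cases hz : z ∈ centeredRect (a * r₁) (b * r₂) u
      · rw [indicator_of_mem hz, hk, indicator_of_mem (show (z, u) ∈ D from ⟨hz, hu⟩)]
      · rw [indicator_of_notMem hz, hk, indicator_of_notMem (fun h : (z, u) ∈ D => hz h.1),
          zero_mul]
    · rw [indicator_of_notMem hu]
      refine (lintegral_congr fun z => ?_).trans lintegral_zero
      rw [hk, indicator_of_notMem (fun h : (z, u) ∈ D => hu h.2), zero_mul]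
  calc _ ≤ ∫⁻ z in R, J * ∫⁻ u, k (z, u) * W z := setLIntegral_mono' hRm inner
    _ ≤ ∫⁻ z, J * ∫⁻ u, k (z, u) * W z := setLIntegral_le_lintegral _ _
    _ = J * ∫⁻ u in R, G u * ∫⁻ z in centeredRect (a * r₁) (b * r₂) u, W z := by
        rw [lintegral_const_mul _ (Measurable.lintegral_prod_right'
          (f := fun p : (E n₁ × E n₂) × (E n₁ × E n₂) => k p * W p.1) (by fun_prop)),
          lintegral_lintegral_swap (by fun_prop), ← lintegral_indicator hRm]
        simp only [outer]
    _ ≤ J * ∫⁻ u in R, κ * (ENNReal.ofReal (3 * (a * r₁)) ^ n₁ *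
          ENNReal.ofReal (3 * (b * r₂)) ^ n₂) * (G u * W u) := by
        gcongr J * ?_
        refine lintegral_mono_ae ((ae_restrict_of_ae hA).mono fun u hu => ?_)
        refine (mul_le_mul_right hu _).trans_eq (by ring)
    _ = _ := by
        rw [lintegral_const_mul _ (by fun_prop), ← mul_assoc]
        congr 1
        have e1 : ENNReal.ofReal (3 * (a * r₁)) = ENNReal.ofReal a * ENNReal.ofReal (3 * r₁) := by
          rw [← ENNReal.ofReal_mul ha0.le]; ring_nf
        have e2 : ENNReal.ofReal (3 * (b * r₂)) = ENNReal.ofReal b * ENNReal.ofReal (3 * r₂) := by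
          rw [← ENNReal.ofReal_mul hb0.le]; ring_nf
        have c1 : (ENNReal.ofReal a ^ n₁)⁻¹ * ENNReal.ofReal a ^ n₁ = 1 :=
          ENNReal.inv_mul_cancel (by simp [ha0]) (by finiteness)
        have c2 : (ENNReal.ofReal b ^ n₂)⁻¹ * ENNReal.ofReal b ^ n₂ = 1 :=
          ENNReal.inv_mul_cancel (by simp [hb0]) (by finiteness)
        rw [e1, e2, hJ, mul_pow, mul_pow]
        calc _ = ((ENNReal.ofReal a ^ n₁)⁻¹ * ENNReal.ofReal a ^ n₁) *
              ((ENNReal.ofReal b ^ n₂)⁻¹ * ENNReal.ofReal b ^ n₂) *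
              (κ * (ENNReal.ofReal (3 * r₁) ^ n₁ * ENNReal.ofReal (3 * r₂) ^ n₂)) := by ring
          _ = _ := by rw [c1, c2, one_mul, one_mul]

/-- `f - π_R f` is the average over `R` of the rectangular second differences of `f`. -/
theorem sub_piR_eq_average {n₁ n₂ : ℕ} {f : E n₁ × E n₂ → ℝ} (hf : Continuous f)
    (a₁ : E n₁) {r₁ : ℝ} (a₂ : E n₂) {r₂ : ℝ} (hr₁ : 0 < r₁) (hr₂ : 0 < r₂) (z : E n₁ × E n₂) :
    f z - piR a₁ r₁ a₂ r₂ f z = ⨍ u in rect a₁ r₁ a₂ r₂,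
      (f z - f (u.1, z.2) - f (z.1, u.2) + f u) := by
  have hv₁ : volume.real (cube a₁ r₁) ≠ 0 := by
    simp [Measure.real, volume_cube, hr₁.le, hr₁.ne']
  have hv₂ : volume.real (cube a₂ r₂) ≠ 0 := by
    simp [Measure.real, volume_cube, hr₂.le, hr₂.ne']
  have hi : ∀ g : E n₁ × E n₂ → ℝ, Continuous g → IntegrableOn g (rect a₁ r₁ a₂ r₂) :=
    fun g hg => hg.continuousOn.integrableOn_compact (isCompact_rect _ _ _ _)
  have hp : (volume : Measure (E n₁ × E n₂)).restrict (rect a₁ r₁ a₂ r₂) =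
      (volume.restrict (cube a₁ r₁)).prod (volume.restrict (cube a₂ r₂)) := by
    rw [Measure.prod_restrict, rect, Measure.volume_eq_prod]
  have hvol : volume.real (rect a₁ r₁ a₂ r₂) =
      volume.real (cube a₁ r₁) * volume.real (cube a₂ r₂) := by
    rw [rect, Measure.volume_eq_prod, measureReal_prod_prod]
  have hv : volume.real (rect a₁ r₁ a₂ r₂) ≠ 0 := hvol ▸ mul_ne_zero hv₁ hv₂
  have h₁ : ∫ u in rect a₁ r₁ a₂ r₂, f (u.1, z.2) =
      volume.real (cube a₂ r₂) * ∫ x in cube a₁ r₁, f (x, z.2) := by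
    rw [hp, integral_fun_fst (fun x => f (x, z.2))]; simp
  have h₂ : ∫ u in rect a₁ r₁ a₂ r₂, f (z.1, u.2) =
      volume.real (cube a₁ r₁) * ∫ y in cube a₂ r₂, f (z.1, y) := by
    rw [hp, integral_fun_snd (fun y => f (z.1, y))]; simp
  have hint : ∫ u in rect a₁ r₁ a₂ r₂, (f z - f (u.1, z.2) - f (z.1, u.2) + f u) =
      volume.real (rect a₁ r₁ a₂ r₂) * f z -
        volume.real (cube a₂ r₂) * (∫ x in cube a₁ r₁, f (x, z.2)) -
        volume.real (cube a₁ r₁) * (∫ y in cube a₂ r₂, f (z.1, y)) +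
        ∫ u in rect a₁ r₁ a₂ r₂, f u := by
    rw [integral_add (hi _ (by fun_prop)) (hi _ hf), integral_sub (hi _ (by fun_prop))
      (hi _ (by fun_prop)), integral_sub (hi _ (by fun_prop)) (hi _ (by fun_prop)), h₁, h₂]
    simp
  simp only [piR, setAverage_eq, hint, smul_eq_mul, hvol]
  field_simp
  ring

theorem enorm_setAverage_le {α : Type*} [MeasurableSpace α] (μ : Measure α) (s : Set α)
    (g : α → ℝ) : ‖⨍ x in s, g x ∂μ‖ₑ ≤ (μ s)⁻¹ * ∫⁻ x in s, ‖g x‖ₑ ∂μ := by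
  rw [average]
  refine (enorm_integral_le_lintegral_enorm _).trans_eq ?_
  rw [lintegral_smul_measure, Measure.restrict_apply_univ, smul_eq_mul]

theorem lintegral_pairs_swap {α β : Type*} [MeasurableSpace α] [MeasurableSpace β]
    (μ : Measure α) (ν : Measure β) [SFinite μ] [SFinite ν]
    {F : (α × α) × (β × β) → ℝ≥0∞} (hF : Measurable F) :
    ∫⁻ x, ∫⁻ y, ∫⁻ b, ∫⁻ a, F ((x, y), (b, a)) ∂ν ∂ν ∂μ ∂μ =
      ∫⁻ b, ∫⁻ a, ∫⁻ x, ∫⁻ y, F ((x, y), (b, a)) ∂μ ∂μ ∂ν ∂ν := by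
  have h₁ : ∀ p, ∫⁻ b, ∫⁻ a, F (p, (b, a)) ∂ν ∂ν = ∫⁻ q, F (p, q) ∂ν.prod ν := fun p =>
    (lintegral_prod (fun q => F (p, q)) (by fun_prop)).symm
  have h₂ : ∀ q, ∫⁻ x, ∫⁻ y, F ((x, y), q) ∂μ ∂μ = ∫⁻ p, F (p, q) ∂μ.prod μ := fun q =>
    (lintegral_prod (fun p => F (p, q)) (by fun_prop)).symm
  simp only [h₁, h₂]
  rw [← lintegral_prod (fun p => ∫⁻ q, F (p, q) ∂ν.prod ν)
      hF.lintegral_prod_right'.aemeasurable,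
    ← lintegral_prod (fun q => ∫⁻ p, F (p, q) ∂μ.prod μ)
      hF.lintegral_prod_left'.aemeasurable]
  exact lintegral_lintegral_swap hF.aemeasurable

/-- Proposition 1.7 of the paper: for `w ∈ A_{1,ℛ}`,
`∫_R |f - π_R(f)| w ≲ ℓ(I₁) ℓ(I₂) [w]_{A_{1,ℛ}}² ∫_R |∇ₓ∇_y f| w`
uniformly in `R = I₁ × I₂ ∈ ℛ`, for `f ∈ C²`. -/
theorem weighted_11_biparam_poincare (n₁ n₂ : ℕ) (hn₁ : 0 < n₁) (hn₂ : 0 < n₂) :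
    ∃ C : ℝ, 0 < C ∧
      ∀ (w : E n₁ × E n₂ → ℝ), (∀ z, 0 ≤ w z) → LocallyIntegrable w volume →
        ∀ K : ℝ, 1 ≤ K → rectA1Bound n₁ n₂ K w →
          ∀ (a₁ : E n₁) (r₁ : ℝ) (a₂ : E n₂) (r₂ : ℝ), 0 < r₁ → 0 < r₂ →
            ∀ f : E n₁ × E n₂ → ℝ, ContDiff ℝ 2 f →
              (∫⁻ z in rect a₁ r₁ a₂ r₂,
                  ENNReal.ofReal |f z - piR a₁ r₁ a₂ r₂ f z| * ENNReal.ofReal (w z))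
                ≤ ENNReal.ofReal (C * r₁ * r₂ * K ^ 2) *
                  ∫⁻ z in rect a₁ r₁ a₂ r₂,
                    ENNReal.ofReal (mixedGradNorm f z) * ENNReal.ofReal (w z) := by
  refine ⟨n₁ * n₂ * 3 ^ (n₁ + n₂), by positivity, ?_⟩
  intro w _ hw K hK hA a₁ r₁ a₂ r₂ hr₁ hr₂ f hf
  have hWm : AEMeasurable (fun z => ENNReal.ofReal (w z)) :=
    hw.aestronglyMeasurable.aemeasurable.ennreal_ofReal
  set W := hWm.mk with hWdef
  have hW : Measurable W := hWm.measurable_mk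
  have hWae : (fun z => ENNReal.ofReal (w z)) =ᵐ[volume] W := hWm.ae_eq_mk
  set R := rect a₁ r₁ a₂ r₂ with hR
  have hRm : MeasurableSet R := measurableSet_rect _ _ _ _
  set G : E n₁ × E n₂ → ℝ≥0∞ := fun z => ENNReal.ofReal (mixedGradNorm f z) with hGdef
  have hG : Measurable G := (continuous_mixedGradNorm hf).measurable.ennreal_ofReal
  have hcongr : ∀ g : E n₁ × E n₂ → ℝ≥0∞,
      ∫⁻ z in R, g z * ENNReal.ofReal (w z) = ∫⁻ z in R, g z * W z := fun g =>
    lintegral_congr_ae ((ae_restrict_of_ae hWae).mono fun z hz => congrArg (g z * ·) hz)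
  rw [hcongr, hcongr]
  have hA' : ∀ h₁ h₂ : ℝ, 0 < h₁ → 0 < h₂ → ∀ᵐ u, ∫⁻ z in centeredRect h₁ h₂ u, W z ≤
      ENNReal.ofReal K * (ENNReal.ofReal (3 * h₁) ^ n₁ * ENNReal.ofReal (3 * h₂) ^ n₂) * W u := by
    intro h₁ h₂ hh₁ hh₂
    filter_upwards [ae_lintegral_centeredRect_le hA hh₁ hh₂, hWae] with u hu hwu
    rw [← hwu, ← lintegral_congr_ae (ae_restrict_of_ae hWae)]
    exact hu
  set c : ℝ≥0∞ := ENNReal.ofReal (n₁ * n₂ * r₁ * r₂) with hc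
  set V : ℝ≥0∞ := volume R with hV
  have hpt : ∀ z ∈ R, ENNReal.ofReal |f z - piR a₁ r₁ a₂ r₂ f z| * W z ≤
      V⁻¹ * c * ∫⁻ u in R, ∫⁻ b in Ioc (0:ℝ) 1, ∫⁻ a in Ioc (0:ℝ) 1,
        G (z.1 + a • (u.1 - z.1), z.2 + b • (u.2 - z.2)) * W z := by
    intro z hz
    have e : (∫⁻ u in R, ∫⁻ b in Ioc (0:ℝ) 1, ∫⁻ a in Ioc (0:ℝ) 1,
        G (z.1 + a • (u.1 - z.1), z.2 + b • (u.2 - z.2))) * W z ≤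
        ∫⁻ u in R, ∫⁻ b in Ioc (0:ℝ) 1, ∫⁻ a in Ioc (0:ℝ) 1,
        G (z.1 + a • (u.1 - z.1), z.2 + b • (u.2 - z.2)) * W z :=
      (lintegral_mul_const_le _ _).trans <| lintegral_mono fun u =>
        (lintegral_mul_const_le _ _).trans <| lintegral_mono fun b => lintegral_mul_const_le _ _
    have hct : c ≠ ⊤ := ENNReal.ofReal_ne_top
    refine le_trans ?_ (mul_le_mul_right e _)
    rw [← mul_assoc, mul_assoc V⁻¹, ← lintegral_const_mul' _ _ hct]
    simp only [← lintegral_const_mul' _ _ hct]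
    gcongr
    rw [← Real.enorm_eq_ofReal_abs, sub_piR_eq_average hf.continuous a₁ a₂ hr₁ hr₂]
    refine (enorm_setAverage_le _ _ _).trans ?_
    gcongr V⁻¹ * ?_
    refine setLIntegral_mono' hRm fun u hu => ?_
    exact enorm_doubleDiff_le hf hr₁.le (abs_sub_le_of_mem_cube hz.1 hu.1)
      (abs_sub_le_of_mem_cube hz.2 hu.2)
  have hV0 : V ≠ 0 := by
    rw [hV, hR, volume_rect]
    exact mul_ne_zero (pow_ne_zero _ (by simpa using hr₁)) (pow_ne_zero _ (by simpa using hr₂))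
  have hVt : V ≠ ⊤ := (isCompact_rect _ _ _ _).measure_ne_top
  have hV3 : ENNReal.ofReal (3 * r₁) ^ n₁ * ENNReal.ofReal (3 * r₂) ^ n₂ =
      ENNReal.ofReal (3 ^ (n₁ + n₂)) * V := by
    rw [hV, hR, volume_rect, ENNReal.ofReal_mul (by norm_num), ENNReal.ofReal_mul (by norm_num),
      ENNReal.ofReal_pow (by norm_num)]
    ring
  set I : ℝ≥0∞ := ∫⁻ z in R, G z * W z with hI
  have hΦ : Measurable fun p : ((E n₁ × E n₂) × (E n₁ × E n₂)) × (ℝ × ℝ) =>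
      G (p.1.1.1 + p.2.2 • (p.1.2.1 - p.1.1.1), p.1.1.2 + p.2.1 • (p.1.2.2 - p.1.1.2)) *
        W p.1.1 := by fun_prop
  calc _ ≤ ∫⁻ z in R, V⁻¹ * c * ∫⁻ u in R, ∫⁻ b in Ioc (0:ℝ) 1, ∫⁻ a in Ioc (0:ℝ) 1,
        G (z.1 + a • (u.1 - z.1), z.2 + b • (u.2 - z.2)) * W z := setLIntegral_mono' hRm hpt
    _ = V⁻¹ * c * ∫⁻ z in R, ∫⁻ u in R, ∫⁻ b in Ioc (0:ℝ) 1, ∫⁻ a in Ioc (0:ℝ) 1,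
        G (z.1 + a • (u.1 - z.1), z.2 + b • (u.2 - z.2)) * W z :=
        lintegral_const_mul' _ _ (by finiteness)
    _ = V⁻¹ * c * ∫⁻ b in Ioc (0:ℝ) 1, ∫⁻ a in Ioc (0:ℝ) 1, ∫⁻ z in R, ∫⁻ u in R,
        G (z.1 + a • (u.1 - z.1), z.2 + b • (u.2 - z.2)) * W z := by
        congr 1
        exact lintegral_pairs_swap _ _ hΦ
    _ ≤ V⁻¹ * c * ∫⁻ _ in Ioc (0:ℝ) 1, ∫⁻ _ in Ioc (0:ℝ) 1,
        ENNReal.ofReal K * (ENNReal.ofReal (3 * r₁) ^ n₁ * ENNReal.ofReal (3 * r₂) ^ n₂) * I := by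
        gcongr V⁻¹ * c * ?_
        refine setLIntegral_mono' measurableSet_Ioc fun b hb => ?_
        refine setLIntegral_mono' measurableSet_Ioc fun a ha => ?_
        exact lintegral_mul_lintegral_contraction_le hW hG ha hb
          (hA' _ _ (mul_pos ha.1 hr₁) (mul_pos hb.1 hr₂))
    _ = (V⁻¹ * V) * (c * ENNReal.ofReal (3 ^ (n₁ + n₂)) * ENNReal.ofReal K) * I := by
        rw [hV3]
        simp
        ring
    _ ≤ _ := by
        rw [ENNReal.inv_mul_cancel hV0 hVt, one_mul, hc, ← ENNReal.ofReal_mul (by positivity),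
          ← ENNReal.ofReal_mul (by positivity)]
        gcongr ENNReal.ofReal ?_ * _
        calc _ = n₁ * n₂ * 3 ^ (n₁ + n₂) * r₁ * r₂ * K := by ring
          _ ≤ _ := by
            gcongr
            nlinarith
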